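/- arXiv:1611.01324 — 2 statements merged into one kernel-verified Lean document; each statement's English description precedes it below -/
import Mathlib

section
/- Let f : ℝ → ℝ be infinitely differentiable on an open set U ⊆ ℝ with 0 ∉ U, and let n ≥ 0 be an integer. Then on U one has d²/dx² ((x⁻¹ d/dx)ⁿ f)(x) = ((x⁻¹ d/dx)ⁿ (f''))(x) − 2n ((x⁻¹ d/dx)^{n+1} f)(x), where (x⁻¹ d/dx)ⁿ denotes the n-fold composition of the operator g ↦ x⁻¹ g'(x). -/
noncomputable section

/-- The operator `(x⁻¹ d/dx)ⁿ`: the `n`-fold iterate of `g ↦ (x ↦ x⁻¹ * g' x)`. -/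
def opA (n : ℕ) : (ℝ → ℝ) → ℝ → ℝ :=
  (fun g (x : ℝ) => x⁻¹ * deriv g x)^[n]

theorem opA_succ_apply (n : ℕ) (f : ℝ → ℝ) (x : ℝ) :
    opA (n + 1) f x = x⁻¹ * deriv (opA n f) x := by
  rw [opA, Function.iterate_succ_apply']
  rfl

theorem ContDiffOn.deriv_infty {U : Set ℝ} (hU : IsOpen U) {f : ℝ → ℝ}
    (hf : ContDiffOn ℝ (⊤ : ℕ∞) f U) : ContDiffOn ℝ (⊤ : ℕ∞) (deriv f) U :=
  hf.deriv_of_isOpen hU (by simp)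

theorem ContDiffOn.opA {U : Set ℝ} (hU : IsOpen U) (hU0 : (0 : ℝ) ∉ U) {f : ℝ → ℝ}
    (hf : ContDiffOn ℝ (⊤ : ℕ∞) f U) (n : ℕ) : ContDiffOn ℝ (⊤ : ℕ∞) (opA n f) U := by
  induction n with
  | zero => exact hf
  | succ n ih =>
    have hinv : ContDiffOn ℝ (⊤ : ℕ∞) (fun x : ℝ => x⁻¹) U :=
      contDiffOn_id.inv fun x hx h => hU0 (h ▸ hx)
    exact (hinv.mul (ih.deriv_infty hU)).congr fun x _ => opA_succ_apply n f x

theorem ContDiffOn.differentiableAt_of_isOpen {U : Set ℝ} (hU : IsOpen U) {f : ℝ → ℝ}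
    (hf : ContDiffOn ℝ (⊤ : ℕ∞) f U) {x : ℝ} (hx : x ∈ U) : DifferentiableAt ℝ f x :=
  (hf.contDiffAt (hU.mem_nhds hx)).differentiableAt (by simp)

/-- The first derivative of `x⁻¹ * h x` at a nonzero point. -/
theorem deriv_inv_mul {h : ℝ → ℝ} {x : ℝ} (hx : x ≠ 0) (hh : DifferentiableAt ℝ h x) :
    deriv (fun y => y⁻¹ * h y) x = -(x ^ 2)⁻¹ * h x + x⁻¹ * deriv h x :=
  ((hasDerivAt_inv hx).mul hh.hasDerivAt).deriv

/-- The second derivative of `x⁻¹ * h x`, for `h` smooth on an open set avoiding `0`. -/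
theorem deriv_deriv_inv_mul {U : Set ℝ} (hU : IsOpen U) (hU0 : (0 : ℝ) ∉ U) {h : ℝ → ℝ}
    (hh : ContDiffOn ℝ (⊤ : ℕ∞) h U) {x : ℝ} (hx : x ∈ U) :
    deriv (deriv fun y => y⁻¹ * h y) x
      = x⁻¹ * deriv (deriv h) x - 2 * (x⁻¹ * deriv (fun y => y⁻¹ * h y) x) := by
  have hne : ∀ y ∈ U, y ≠ 0 := fun y hy h => hU0 (h ▸ hy)
  have hx0 := hne x hx
  have hd := hh.differentiableAt_of_isOpen hU hx
  have hd' := (hh.deriv_infty hU).differentiableAt_of_isOpen hU hx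
  have hev : (deriv fun y => y⁻¹ * h y) =ᶠ[nhds x]
      fun y => -(y ^ 2)⁻¹ * h y + y⁻¹ * deriv h y := by
    filter_upwards [hU.mem_nhds hx] with y hy
    exact deriv_inv_mul (hne y hy) (hh.differentiableAt_of_isOpen hU hy)
  have hsq := (((hasDerivAt_pow 2 x).fun_inv (pow_ne_zero 2 hx0)).fun_neg.fun_mul
    hd.hasDerivAt).fun_add ((hasDerivAt_inv hx0).fun_mul hd'.hasDerivAt)
  rw [hev.deriv_eq, hsq.deriv, deriv_inv_mul hx0 hd]
  field_simp
  ring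

/-- **Lemma (i).** For `f` smooth on an open set `U` not containing `0`,
`d²/dx² ((x⁻¹ d/dx)ⁿ f) = (x⁻¹ d/dx)ⁿ (f'') − 2n (x⁻¹ d/dx)^{n+1} f` on `U`. -/
theorem opA_second_deriv (U : Set ℝ) (hU : IsOpen U) (hU0 : (0 : ℝ) ∉ U)
    (f : ℝ → ℝ) (hf : ContDiffOn ℝ (⊤ : ℕ∞) f U) (n : ℕ) :
    ∀ x ∈ U,
      deriv (deriv (opA n f)) x
        = opA n (deriv (deriv f)) x - 2 * n * opA (n + 1) f x := by
  induction n with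
  | zero => intro x _; simp [opA]
  | succ n ih =>
    intro x hx
    have hsmooth := hf.opA hU hU0 n
    have hstep : opA (n + 1) f = fun y => y⁻¹ * deriv (opA n f) y :=
      funext (opA_succ_apply n f)
    have hev : deriv (deriv (opA n f)) =ᶠ[nhds x]
        fun y => opA n (deriv (deriv f)) y - 2 * n * opA (n + 1) f y := by
      filter_upwards [hU.mem_nhds hx] with y hy using ih y hy
    have hd₁ : DifferentiableAt ℝ (opA n (deriv (deriv f))) x :=
      (((hf.deriv_infty hU).deriv_infty hU).opA hU hU0 n).differentiableAt_of_isOpen hU hx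
    have hd₂ : DifferentiableAt ℝ (opA (n + 1) f) x :=
      (hf.opA hU hU0 (n + 1)).differentiableAt_of_isOpen hU hx
    have hmain := deriv_deriv_inv_mul hU hU0 (hsmooth.deriv_infty hU) hx
    rw [← hstep, hev.deriv_eq,
      (hd₁.hasDerivAt.fun_sub (hd₂.hasDerivAt.const_mul (2 * (n : ℝ)))).deriv] at hmain
    rw [hmain, opA_succ_apply n (deriv (deriv f)), opA_succ_apply (n + 1) f]
    push_cast
    ring

end
end

section
/- Let f : ℝ → ℝ be infinitely differentiable on an open set U ⊆ ℝ with 0 ∉ U, and let n ≥ 0 be an integer. Then on U one has ((x⁻¹ d/dx)ⁿ (f'))(x) − d/dx ((d/dx x⁻¹)ⁿ f)(x) = 2n x⁻¹ ((d/dx x⁻¹)ⁿ f)(x). -/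
noncomputable section

/-- The operator `(d/dx x⁻¹)ⁿ`: the `n`-fold iterate of `g ↦ (x ↦ (x⁻¹ * g x)')`. -/
def opB (n : ℕ) : (ℝ → ℝ) → ℝ → ℝ :=
  (fun g (x : ℝ) => deriv (fun t => t⁻¹ * g t) x)^[n]

/-- The operator `(d/dx x⁻¹)ⁿ` preserves smoothness on open sets avoiding `0`. -/
lemma contDiffOn_opB {U : Set ℝ} (hU : IsOpen U) (hU0 : (0 : ℝ) ∉ U)
    {f : ℝ → ℝ} (hf : ContDiffOn ℝ (⊤ : ℕ∞) f U) (n : ℕ) :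
    ContDiffOn ℝ (⊤ : ℕ∞) (opB n f) U := by
  induction n with
  | zero => exact hf
  | succ n ih =>
    rw [opB, Function.iterate_succ_apply']
    have hinv : ContDiffOn ℝ (⊤ : ℕ∞) (fun t : ℝ => t⁻¹) U :=
      contDiffOn_id.inv fun x hx h => hU0 (h ▸ hx)
    exact (hinv.mul ih).deriv_of_isOpen hU (by simp)

/-- **Lemma (iv).** For `f` smooth on an open set `U` not containing `0`,
`(x⁻¹ d/dx)ⁿ (f') − d/dx ((d/dx x⁻¹)ⁿ f) = 2n x⁻¹ (d/dx x⁻¹)ⁿ f` on `U`. -/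
theorem opA_deriv_sub_deriv_opB (U : Set ℝ) (hU : IsOpen U) (hU0 : (0 : ℝ) ∉ U)
    (f : ℝ → ℝ) (hf : ContDiffOn ℝ (⊤ : ℕ∞) f U) (n : ℕ) :
    ∀ x ∈ U,
      opA n (deriv f) x - deriv (opB n f) x = 2 * n * x⁻¹ * opB n f x := by
  induction n with
  | zero => simp [opA, opB]
  | succ n ih =>
    intro x hx
    have hx0 : ∀ y ∈ U, y ≠ 0 := fun y hy h => hU0 (h ▸ hy)
    set h : ℝ → ℝ := fun t => t⁻¹ * opB n f t with h_def
    have hB : opB (n + 1) f = deriv h := by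
      simp only [opB, Function.iterate_succ_apply', h_def]
    have hA : opA (n + 1) (deriv f) x = x⁻¹ * deriv (opA n (deriv f)) x := by
      simp only [opA, Function.iterate_succ_apply']
    have h_smooth : ContDiffOn ℝ (⊤ : ℕ∞) h U :=
      (contDiffOn_id.inv hx0).mul (contDiffOn_opB hU hU0 hf n)
    have h_diff : ∀ y ∈ U, HasDerivAt h (deriv h y) y := fun y hy =>
      ((h_smooth.differentiableOn (by simp)).differentiableAt (hU.mem_nhds hy)).hasDerivAt
    have h_diff' : HasDerivAt (deriv h) (deriv (deriv h) x) x :=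
      (((h_smooth.deriv_of_isOpen (m := (⊤ : ℕ∞)) hU (by simp)).differentiableOn
        (by simp)).differentiableAt (hU.mem_nhds hx)).hasDerivAt
    have hmul : Set.EqOn (opB n f) (fun t => t * h t) U := fun y hy => by
      simp [h_def, mul_inv_cancel_left₀ (hx0 y hy)]
    have hA_eq : Set.EqOn (opA n (deriv f))
        (fun y => (2 * n + 1) * h y + y * deriv h y) U := fun y hy => by
      have hd : deriv (opB n f) y = 1 * h y + y * deriv h y :=
        (hmul.eventuallyEq_of_mem (hU.mem_nhds hy)).deriv_eq.trans
          ((hasDerivAt_id y).mul (h_diff y hy)).deriv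
      have := ih y hy
      rw [hd, mul_assoc _ y⁻¹] at this
      change _ = _ * h y at this
      linear_combination this
    have hdA : deriv (opA n (deriv f)) x =
        (2 * n + 1) * deriv h x + (1 * deriv h x + x * deriv (deriv h) x) :=
      (hA_eq.eventuallyEq_of_mem (hU.mem_nhds hx)).deriv_eq.trans
        (((h_diff x hx).const_mul _).add ((hasDerivAt_id x).mul h_diff')).deriv
    rw [hA, hB, hdA]
    have := hx0 x hx
    push_cast
    field_simp
    ring

end
end
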